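/- For every pseudo-composition α of n, the type B ribbon number r^B_α = |{w ∈ B_n : D(w) = D(α)}| satisfies r^B_α = Σ_{β ≼ α} (-1)^{ℓ(α)-ℓ(β)} 2^{n-β_1} n!/(β_1!⋯β_ℓ!), where the sum is over pseudo-compositions β of n with D(β) ⊆ D(α). -/

import Mathlib

/-- Signed permutations of `[n]`: bijections `w` of `ℤ` with `w(-i) = -w(i)` that fix
all integers of absolute value greater than `n`.  These form the hyperoctahedral
group `Bₙ`. -/
def SignedPerms (n : ℕ) : Set (ℤ → ℤ) :=
  {w | Function.Bijective w ∧ (∀ i : ℤ, w (-i) = -w i) ∧ ∀ i : ℤ, (n : ℤ) < |i| → w i = i}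

/-- The type B descent set `D(w) = {i ∈ {0,…,n-1} : w(i) > w(i+1)}` (note `w(0) = 0`
automatically). -/
def DesB (n : ℕ) (w : ℤ → ℤ) : Set ℕ :=
  {i | i < n ∧ w ((i : ℤ) + 1) < w (i : ℤ)}

/-- A pseudo-composition of `n`: a sequence `(β₁, …, β_ℓ)` with `β₁ ≥ 0`,
`β₂, …, β_ℓ > 0` and `β₁ + ⋯ + β_ℓ = n`. -/
structure PseudoComposition (n : ℕ) where
  parts : List ℕ
  ne_nil : parts ≠ []
  tail_pos : ∀ i ∈ parts.tail, 0 < i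
  sum_eq : parts.sum = n

/-- The descent set `D(β) = {β₁, β₁+β₂, …, β₁+⋯+β_{ℓ-1}} ⊆ {0,…,n-1}` of a
pseudo-composition. -/
def DsetB {n : ℕ} (β : PseudoComposition n) : Set ℕ :=
  {m | ∃ i, 0 < i ∧ i < β.parts.length ∧ (β.parts.take i).sum = m}

/-- The type B ribbon number `r^B_α = |{w ∈ Bₙ : D(w) = D(α)}|`. -/
noncomputable def ribbonB {n : ℕ} (α : PseudoComposition n) : ℕ :=
  Set.ncard {w ∈ SignedPerms n | DesB n w = DsetB α}
attribute [local instance] Classical.propDecidable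

/-- Partial sums of `γ` started at `a`, with the total sum left out. -/
def partialSums : ℕ → List ℕ → Finset ℕ
  | _, [] => ∅
  | a, k :: γ => insert a (partialSums (a + k) γ)

lemma le_of_mem_partialSums {x : ℕ} (γ : List ℕ) (a : ℕ) (h : x ∈ partialSums a γ) : a ≤ x := by
  induction γ generalizing a with
  | nil => simp [partialSums] at h
  | cons k γ ih =>
    rcases Finset.mem_insert.1 h with rfl | h
    · rfl
    · exact (Nat.le_add_right _ _).trans (ih _ h)

lemma lt_of_mem_partialSums {x : ℕ} (γ : List ℕ) (hγ : ∀ i ∈ γ, 0 < i) (a : ℕ)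
    (h : x ∈ partialSums a γ) : x < a + γ.sum := by
  induction γ generalizing a with
  | nil => simp [partialSums] at h
  | cons k γ ih =>
    have hk := hγ k (by simp)
    rw [List.sum_cons]
    rcases Finset.mem_insert.1 h with rfl | h
    · omega
    · have := ih (fun i hi => hγ i (by simp [hi])) _ h
      omega

lemma add_one_mem_partialSums {x : ℕ} (γ : List ℕ) (a : ℕ) :
    x + 1 ∈ partialSums (a + 1) γ ↔ x ∈ partialSums a γ := by
  induction γ generalizing a with
  | nil => simp [partialSums]
  | cons k γ ih => simp [partialSums, Nat.add_right_comm a 1 k, ih]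

lemma notMem_partialSums (γ : List ℕ) {a b : ℕ} (h : a < b) : a ∉ partialSums b γ :=
  fun hm => absurd (le_of_mem_partialSums γ b hm) (by omega)

lemma card_partialSums (γ : List ℕ) (hγ : ∀ i ∈ γ, 0 < i) (a : ℕ) :
    (partialSums a γ).card = γ.length := by
  induction γ generalizing a with
  | nil => simp [partialSums]
  | cons k γ ih =>
    have hk := hγ k (by simp)
    rw [partialSums, Finset.card_insert_of_notMem (notMem_partialSums _ (by omega)),
      ih (fun i hi => hγ i (by simp [hi])), List.length_cons]

lemma partialSums_injective {m m' : ℕ} {γ γ' : List ℕ} (hγ : ∀ i ∈ γ, 0 < i)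
    (hγ' : ∀ i ∈ γ', 0 < i) (hsum : m + γ.sum = m' + γ'.sum)
    (h : partialSums m γ = partialSums m' γ') : m = m' ∧ γ = γ' := by
  induction γ generalizing m m' γ' with
  | nil =>
    cases γ' with
    | nil => simpa using hsum
    | cons k' γ' => exact absurd h.symm (Finset.insert_ne_empty _ _)
  | cons k γ ih =>
    cases γ' with
    | nil => exact absurd h (Finset.insert_ne_empty _ _)
    | cons k' γ' =>
      have hk := hγ k (by simp)
      have hk' := hγ' k' (by simp)
      have hm : m = m' := le_antisymm
        (le_of_mem_partialSums (k :: γ) m (h ▸ Finset.mem_insert_self _ _))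
        (le_of_mem_partialSums (k' :: γ') m' (h ▸ Finset.mem_insert_self _ _))
      subst hm
      have h' : partialSums (m + k) γ = partialSums (m + k') γ' := by
        rw [← Finset.erase_insert (notMem_partialSums γ (show m < m + k by omega)),
          ← Finset.erase_insert (notMem_partialSums γ' (show m < m + k' by omega))]
        exact congrArg (Finset.erase · m) h
      simp only [List.sum_cons] at hsum
      obtain ⟨h1, h2⟩ := ih (fun i hi => hγ i (by simp [hi])) (fun i hi => hγ' i (by simp [hi]))
        (by omega) h'
      exact ⟨rfl, by rw [h2, Nat.add_left_cancel h1]⟩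

lemma exists_partialSums_eq (n : ℕ) (T : Finset ℕ) (hT : ∀ x ∈ T, x < n) :
    ∃ m γ, (∀ i ∈ γ, 0 < i) ∧ m + γ.sum = n ∧ partialSums m γ = T := by
  induction T using Finset.induction_on_min with
  | empty => exact ⟨n, [], by simp [partialSums]⟩
  | insert a T ha ih =>
    obtain ⟨m, γ, hγ, hsum, rfl⟩ := ih fun x hx => hT x (by simp [hx])
    have ham : a < m := by
      cases γ with
      | nil => have := hT a (by simp); simp at hsum; omega
      | cons k γ => exact ha m (Finset.mem_insert_self _ _)
    refine ⟨a, (m - a) :: γ, ?_, ?_, ?_⟩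
    · simpa [ham] using hγ
    · rw [List.sum_cons]; omega
    · rw [partialSums, Nat.add_sub_cancel' ham.le]

lemma mem_partialSums_iff {x : ℕ} (γ : List ℕ) (a : ℕ) :
    x ∈ partialSums a γ ↔ ∃ i < γ.length, a + (γ.take i).sum = x := by
  induction γ generalizing a with
  | nil => simp [partialSums]
  | cons k γ ih =>
    rw [partialSums, Finset.mem_insert, ih]
    constructor
    · rintro (rfl | ⟨i, hi, rfl⟩)
      · exact ⟨0, by simp⟩
      · exact ⟨i + 1, by simp [hi, add_assoc]⟩
    · rintro ⟨_ | i, hi, rfl⟩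
      · simp
      · exact Or.inr ⟨i, by simpa using hi, by simp [add_assoc]⟩

/-- The list `l` splits into strictly increasing blocks whose lengths are given by `γ`. -/
def IncreasingBlocks : List ℕ → List ℤ → Prop
  | [], l => l = []
  | k :: γ, l => k ≤ l.length ∧ (l.take k).Pairwise (· < ·) ∧ IncreasingBlocks γ (l.drop k)

lemma IncreasingBlocks.length_eq {γ : List ℕ} {l : List ℤ} (h : IncreasingBlocks γ l) :
    l.length = γ.sum := by
  induction γ generalizing l with
  | nil => rw [show l = [] from h]; rfl
  | cons k γ ih =>
    have := ih h.2.2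
    have := h.1
    simp at *
    omega

lemma pairwise_lt_iff_getElem_succ (l : List ℤ) :
    l.Pairwise (· < ·) ↔ ∀ j (hj : j + 1 < l.length), l[j] < l[j + 1] := by
  rw [← List.isChain_iff_pairwise, List.isChain_iff_getElem]

lemma increasingBlocks_iff {γ : List ℕ} (hγ : ∀ i ∈ γ, 0 < i) (a : ℕ) (l : List ℤ)
    (hl : l.length = γ.sum) :
    IncreasingBlocks γ l ↔
      ∀ j (hj : j + 1 < l.length), a + j + 1 ∉ partialSums a γ → l[j] < l[j + 1] := by
  induction γ generalizing a l with
  | nil =>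
    have : l = [] := by simpa using hl
    subst this
    simp [IncreasingBlocks]
  | cons k γ ih =>
    have hk := hγ k (by simp)
    rw [List.sum_cons] at hl
    rw [IncreasingBlocks, pairwise_lt_iff_getElem_succ,
      ih (fun i hi => hγ i (by simp [hi])) (a + k) _ (by simp [hl])]
    simp only [List.length_take, List.length_drop, List.getElem_take, List.getElem_drop,
      partialSums, Finset.mem_insert, not_or]
    constructor
    · rintro ⟨-, h1, h2⟩ j hj ⟨-, hm⟩
      rcases lt_trichotomy (j + 1) k with h | h | h
      · exact h1 j (by omega)
      · cases γ with
        | nil => simp at hl; omega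
        | cons k' γ =>
          exact absurd (show a + j + 1 ∈ partialSums (a + k) (k' :: γ) by
            rw [add_assoc, h]; exact Finset.mem_insert_self _ _) hm
      · obtain ⟨i, rfl⟩ : ∃ i, j = k + i := ⟨j - k, by omega⟩
        exact h2 i (by omega) (by simpa only [add_assoc] using hm)
    · refine fun h => ⟨by omega, fun j hj => h j (by omega) ⟨by omega, ?_⟩,
        fun j hj hm => h (k + j) (by omega) ⟨by omega, by simpa only [add_assoc] using hm⟩⟩
      exact notMem_partialSums _ (by omega)

/-- The arrangements of `V` into consecutive increasing blocks with sizes given by `γ`. -/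
def blockWords : List ℕ → Finset ℤ → Finset (List ℤ)
  | [], V => if V = ∅ then {[]} else ∅
  | k :: γ, V => (V.powersetCard k).biUnion fun B => (blockWords γ (V \ B)).image (B.sort ++ ·)

lemma mem_blockWords {γ : List ℕ} {V : Finset ℤ} {l : List ℤ} :
    l ∈ blockWords γ V ↔ l.Nodup ∧ l.toFinset = V ∧ IncreasingBlocks γ l := by
  induction γ generalizing V l with
  | nil =>
    by_cases hV : V = ∅
    · subst hV; simp +contextual [blockWords, IncreasingBlocks]
    · simp only [blockWords, hV, IncreasingBlocks, if_false, Finset.notMem_empty, false_iff]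
      rintro ⟨-, rfl, rfl⟩
      exact hV rfl
  | cons k γ ih =>
    simp only [blockWords, Finset.mem_biUnion, Finset.mem_powersetCard, Finset.mem_image, ih]
    constructor
    · rintro ⟨B, ⟨hB, rfl⟩, l, ⟨h1, h2, h3⟩, rfl⟩
      refine ⟨?_, ?_, by simp, ?_, ?_⟩
      · refine List.Nodup.append (Finset.sort_nodup _ _) h1 fun x hx hx' => ?_
        have : x ∈ V \ B := h2 ▸ List.mem_toFinset.2 hx'
        exact (Finset.mem_sdiff.1 this).2 ((Finset.mem_sort _).1 hx)
      · rw [List.toFinset_append, h2, Finset.sort_toFinset, Finset.union_sdiff_of_subset hB]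
      · rw [List.take_left' (by simp)]
        exact (Finset.sortedLT_sort B).pairwise
      · rwa [List.drop_left' (by simp)]
    · rintro ⟨h1, rfl, hk, h3, h4⟩
      have hs : (l.take k).toFinset.sort = l.take k :=
        (List.toFinset_sort (· ≤ ·) h3.nodup).2 (h3.imp le_of_lt)
      have hd : List.Disjoint (l.take k) (l.drop k) := List.disjoint_take_drop h1 le_rfl
      refine ⟨(l.take k).toFinset, ⟨?_, ?_⟩, l.drop k, ⟨h1.sublist (List.drop_sublist _ _), ?_, h4⟩,
        by rw [hs, List.take_append_drop]⟩
      · exact fun x hx => List.mem_toFinset.2 (List.mem_of_mem_take (List.mem_toFinset.1 hx))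
      · rw [List.toFinset_card_of_nodup h3.nodup, List.length_take, min_eq_left hk]
      · have hu : l.toFinset = (l.take k).toFinset ∪ (l.drop k).toFinset := by
          rw [← List.toFinset_append, List.take_append_drop]
        rw [hu, Finset.union_sdiff_left, Finset.sdiff_eq_self_of_disjoint]
        rw [Finset.disjoint_left]
        exact fun x hx hx' => hd (List.mem_toFinset.1 hx') (List.mem_toFinset.1 hx)

lemma card_blockWords_mul (γ : List ℕ) (V : Finset ℤ) (hV : V.card = γ.sum) :
    (blockWords γ V).card * (γ.map Nat.factorial).prod = V.card.factorial := by
  induction γ generalizing V with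
  | nil =>
    have : V = ∅ := by simpa using hV
    simp [blockWords, this]
  | cons k γ ih =>
    rw [List.sum_cons] at hV
    have hc : ∀ B ∈ V.powersetCard k, (V \ B).card = γ.sum := fun B hB => by
      rw [Finset.mem_powersetCard] at hB
      rw [Finset.card_sdiff_of_subset hB.1]; omega
    rw [blockWords, Finset.card_biUnion, Finset.sum_mul]
    · rw [Finset.sum_congr rfl (g := fun _ => k.factorial * γ.sum.factorial)]
      · rw [Finset.sum_const, Finset.card_powersetCard, smul_eq_mul, ← mul_assoc, hV]
        have := Nat.choose_mul_factorial_mul_factorial (Nat.le_add_right k γ.sum)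
        simpa using this
      · intro B hB
        rw [Finset.card_image_of_injective _ (List.append_right_injective _), List.map_cons,
          List.prod_cons, mul_left_comm, ih _ (hc B hB), hc B hB]
    · intro B hB B' hB' hne
      rw [Function.onFun, Finset.disjoint_left]
      simp only [Finset.mem_image, not_exists, not_and]
      rintro _ ⟨l, -, rfl⟩ l' - h
      rw [Finset.mem_coe, Finset.mem_powersetCard] at hB hB'
      have := (List.append_inj h (by simp [hB.2, hB'.2])).1
      exact hne (by rw [← Finset.sort_toFinset B (· ≤ ·), ← this, Finset.sort_toFinset])

/-- The set of integers with absolute values in `U` whose negative members are the `-s`, `s ∈ S`. -/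
def signedSet (U S : Finset ℕ) : Finset ℤ :=
  (U \ S).image (fun a : ℕ => (a : ℤ)) ∪ S.image (fun a : ℕ => -(a : ℤ))

lemma mem_signedSet {U S : Finset ℕ} {z : ℤ} :
    z ∈ signedSet U S ↔ (0 ≤ z ∧ z.natAbs ∈ U \ S) ∨ (z ≤ 0 ∧ z.natAbs ∈ S) := by
  rw [signedSet, Finset.mem_union, Finset.mem_image, Finset.mem_image]
  refine or_congr ⟨?_, fun h => ⟨z.natAbs, h.2, by omega⟩⟩ ⟨?_, fun h => ⟨z.natAbs, h.2, by omega⟩⟩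
  · rintro ⟨a, ha, rfl⟩; simpa using ha
  · rintro ⟨a, ha, rfl⟩; simpa using ha

lemma natAbs_injOn_signedSet (U S : Finset ℕ) : Set.InjOn Int.natAbs (signedSet U S) := by
  intro x hx y hy h
  rw [Finset.mem_coe, mem_signedSet, Finset.mem_sdiff] at hx hy
  rw [h] at hx
  rcases hx with hx | hx <;> rcases hy with hy | hy
  · omega
  · exact absurd hy.2 hx.2.2
  · exact absurd hx.2 hy.2.2
  · omega

lemma image_natAbs_signedSet {U S : Finset ℕ} (h : S ⊆ U) :
    (signedSet U S).image Int.natAbs = U := by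
  ext a
  simp only [Finset.mem_image, mem_signedSet, Finset.mem_sdiff]
  constructor
  · rintro ⟨z, ⟨-, hz, -⟩ | ⟨-, hz⟩, rfl⟩
    exacts [hz, h hz]
  · intro ha
    by_cases hS : a ∈ S
    · exact ⟨-a, Or.inr (by simpa using hS), by simp⟩
    · exact ⟨a, Or.inl (by simpa using ⟨ha, hS⟩), by simp⟩

lemma card_signedSet {U S : Finset ℕ} (h : S ⊆ U) : (signedSet U S).card = U.card := by
  rw [← Finset.card_image_of_injOn (natAbs_injOn_signedSet U S), image_natAbs_signedSet h]

lemma signedSet_injective {U S S' : Finset ℕ} (hU : 0 ∉ U) (h : S ⊆ U) (h' : S' ⊆ U)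
    (heq : signedSet U S = signedSet U S') : S = S' := by
  have key : ∀ {R}, R ⊆ U → ∀ a, a ∈ R ↔ a ≠ 0 ∧ (-(a : ℤ)) ∈ signedSet U R := by
    intro R hR a
    rw [mem_signedSet]
    constructor
    · intro ha
      exact ⟨fun h0 => hU (h0 ▸ hR ha), Or.inr (by simpa using ha)⟩
    · rintro ⟨h0, ⟨h1, -⟩ | ⟨-, h1⟩⟩
      · omega
      · simpa using h1
  ext a
  rw [key h, key h', heq]

/-- The words whose letters have the elements of `A` as absolute values, that start with an
increasing block of `m` positive letters and continue with increasing blocks of sizes given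
by `γ`. -/
def signedWords (m : ℕ) (γ : List ℕ) (A : Finset ℕ) : Finset (List ℤ) :=
  ((A.powersetCard m).sigma fun T => (A \ T).powerset).biUnion fun p =>
    (blockWords γ (signedSet (A \ p.1) p.2)).image ((p.1.sort.map fun a : ℕ => (a : ℤ)) ++ ·)

lemma mem_signedWords {m : ℕ} {γ : List ℕ} {A : Finset ℕ} (hA : 0 ∉ A) {l : List ℤ} :
    l ∈ signedWords m γ A ↔ (l.map Int.natAbs).Nodup ∧ (l.map Int.natAbs).toFinset = A ∧
      m ≤ l.length ∧ (0 :: l.take m).Pairwise (· < ·) ∧ IncreasingBlocks γ (l.drop m) := by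
  simp only [signedWords, Finset.mem_biUnion, Finset.mem_sigma, Finset.mem_powersetCard,
    Finset.mem_powerset, Finset.mem_image, mem_blockWords]
  constructor
  · rintro ⟨⟨T, S⟩, ⟨⟨hT, rfl⟩, hS⟩, l, ⟨h1, h2, h3⟩, rfl⟩
    dsimp only at *
    have hmap : (T.sort.map fun a : ℕ => (a : ℤ)).map Int.natAbs = T.sort := by
      simp [Function.comp_def]
    have hl : (l.map Int.natAbs).toFinset = A \ T := by
      rw [← image_natAbs_signedSet hS, ← h2]; ext; simp
    refine ⟨?_, ?_, by simp, ?_, ?_⟩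
    · rw [List.map_append, hmap]
      refine List.Nodup.append (Finset.sort_nodup _ _) ?_ fun x hx hx' => ?_
      · refine h1.map_on fun x hx y hy => ?_
        apply natAbs_injOn_signedSet (A \ T) S <;> rw [← h2] <;> simpa
      · have := List.mem_toFinset.2 hx'
        rw [hl, Finset.mem_sdiff] at this
        exact this.2 ((Finset.mem_sort _).1 hx)
    · rw [List.map_append, hmap, List.toFinset_append, hl, Finset.sort_toFinset,
        Finset.union_sdiff_of_subset hT]
    · rw [List.take_left' (by simp), List.pairwise_cons, List.pairwise_map]
      refine ⟨fun z hz => ?_, (Finset.sortedLT_sort T).pairwise.imp (by simp)⟩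
      obtain ⟨a, ha, rfl⟩ := List.mem_map.1 hz
      have : a ≠ 0 := fun h0 => hA (hT (h0 ▸ (Finset.mem_sort _).1 ha))
      omega
    · rwa [List.drop_left' (by simp)]
  · rintro ⟨h1, rfl, hm, h3, h4⟩
    rw [List.pairwise_cons] at h3
    have hcast : ((l.take m).map Int.natAbs).map (fun a : ℕ => (a : ℤ)) = l.take m := by
      rw [List.map_map]
      refine (List.map_congr_left fun z hz => ?_).trans (List.map_id _)
      have := h3.1 z hz
      simp only [Function.comp, id]
      omega
    have hlt : ((l.take m).map Int.natAbs).Pairwise (· < ·) := by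
      have := h3.2
      rw [← hcast, List.pairwise_map] at this
      exact this.imp (by simp)
    have hs : ((l.take m).map Int.natAbs).toFinset.sort = (l.take m).map Int.natAbs :=
      (List.toFinset_sort (· ≤ ·) hlt.nodup).2 (hlt.imp le_of_lt)
    have happ : l.map Int.natAbs = (l.take m).map Int.natAbs ++ (l.drop m).map Int.natAbs := by
      rw [← List.map_append, List.take_append_drop]
    have hd := List.disjoint_of_nodup_append (happ ▸ h1)
    have hsd : (l.map Int.natAbs).toFinset \ ((l.take m).map Int.natAbs).toFinset =
        ((l.drop m).map Int.natAbs).toFinset := by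
      rw [happ, List.toFinset_append, Finset.union_sdiff_left, Finset.sdiff_eq_self_of_disjoint]
      rw [Finset.disjoint_left]
      exact fun x hx hx' => hd (List.mem_toFinset.1 hx') (List.mem_toFinset.1 hx)
    refine ⟨⟨((l.take m).map Int.natAbs).toFinset,
      (((l.drop m).filter (· < 0)).map Int.natAbs).toFinset⟩, ⟨⟨?_, ?_⟩, ?_⟩, l.drop m,
      ⟨h1.of_map.sublist (List.drop_sublist _ _), ?_, h4⟩, ?_⟩
    · dsimp only
      rw [happ, List.toFinset_append]
      exact Finset.subset_union_left
    · dsimp only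
      rw [List.toFinset_card_of_nodup hlt.nodup, List.length_map, List.length_take,
        min_eq_left hm]
    · dsimp only
      rw [hsd]
      intro x hx
      simp only [List.mem_toFinset, List.mem_map, List.mem_filter] at hx ⊢
      obtain ⟨z, ⟨hz, -⟩, rfl⟩ := hx
      exact ⟨z, hz, rfl⟩
    · dsimp only
      rw [hsd]
      have hinj : ∀ x ∈ l.drop m, ∀ y ∈ l.drop m, x.natAbs = y.natAbs → x = y :=
        fun x hx y hy h => List.inj_on_of_nodup_map h1 (List.mem_of_mem_drop hx)
          (List.mem_of_mem_drop hy) h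
      have h0 : (0 : ℤ) ∉ l := fun h => hA (by simpa using h)
      ext z
      simp only [mem_signedSet, List.mem_toFinset, List.mem_map, List.mem_filter, Finset.mem_sdiff,
        decide_eq_true_eq, not_exists, not_and]
      constructor
      · intro hz
        rcases lt_or_ge z 0 with h | h
        · exact Or.inr ⟨h.le, z, ⟨hz, h⟩, rfl⟩
        · refine Or.inl ⟨h, ⟨z, hz, rfl⟩, ?_⟩
          rintro y ⟨hy, hy0⟩ hyz
          have := hinj y hy z hz hyz
          omega
      · rintro (⟨h, ⟨y, hy, hyz⟩, hn⟩ | ⟨h, y, ⟨hy, hy0⟩, hyz⟩)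
        · have : ¬ y < 0 := fun hy0 => hn y ⟨hy, hy0⟩ hyz
          rwa [show z = y by omega]
        · rwa [show z = y by omega]
    · dsimp only
      rw [hs, hcast, List.take_append_drop]

lemma card_signedWords_mul (m : ℕ) (γ : List ℕ) (A : Finset ℕ) (hA : 0 ∉ A)
    (hcard : A.card = m + γ.sum) :
    (signedWords m γ A).card * ((m :: γ).map Nat.factorial).prod =
      2 ^ γ.sum * A.card.factorial := by
  have hc : ∀ T ∈ A.powersetCard m, (A \ T).card = γ.sum := fun T hT => by
    rw [Finset.mem_powersetCard] at hT
    rw [Finset.card_sdiff_of_subset hT.1]; omega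
  rw [signedWords, Finset.card_biUnion, Finset.sum_mul,
    Finset.sum_congr rfl (g := fun _ => m.factorial * γ.sum.factorial), Finset.sum_const,
    Finset.card_sigma, Finset.sum_congr rfl (g := fun _ => 2 ^ γ.sum), Finset.sum_const,
    Finset.card_powersetCard, smul_eq_mul, smul_eq_mul, hcard]
  · have := Nat.choose_mul_factorial_mul_factorial (Nat.le_add_right m γ.sum)
    rw [← this, Nat.add_sub_cancel_left]
    ring
  · intro T hT
    rw [Finset.card_powerset, hc T hT]
  · rintro ⟨T, S⟩ hp
    rw [Finset.mem_sigma, Finset.mem_powerset] at hp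
    have hV := (card_signedSet hp.2).trans (hc T hp.1)
    dsimp only at *
    rw [Finset.card_image_of_injective _ (List.append_right_injective _), List.map_cons,
      List.prod_cons, mul_left_comm, card_blockWords_mul _ _ hV, hV]
  · rintro ⟨T, S⟩ hp ⟨T', S'⟩ hp' hne
    rw [Function.onFun, Finset.disjoint_left]
    simp only [Finset.mem_image, not_exists, not_and, mem_blockWords]
    rintro _ ⟨l, ⟨-, hl, -⟩, rfl⟩ l' ⟨-, hl', -⟩ h
    simp only [Finset.coe_sigma, Set.mem_sigma_iff, Finset.mem_coe, Finset.mem_powersetCard,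
      Finset.mem_powerset] at hp hp'
    obtain ⟨h1, h2⟩ := List.append_inj h (by simp [hp.1.2, hp'.1.2])
    have hT : T' = T := by
      rw [← Finset.sort_toFinset T (· ≤ ·), ← Finset.sort_toFinset T' (· ≤ ·),
        List.map_injective_iff.2 Nat.cast_injective h1]
    subst hT h2
    have hS := signedSet_injective (fun h0 => hA (Finset.mem_sdiff.1 h0).1) hp.2 hp'.2
      (hl.symm.trans hl')
    exact hne (by rw [hS])

lemma SignedPerms.map_zero {n : ℕ} {w : ℤ → ℤ} (hw : w ∈ SignedPerms n) : w 0 = 0 := by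
  have := hw.2.1 0
  rw [neg_zero] at this
  omega

lemma SignedPerms.natAbs_eq_of_apply {n : ℕ} {w : ℤ → ℤ} (hw : w ∈ SignedPerms n) {x y : ℤ}
    (h : (w x).natAbs = (w y).natAbs) : x.natAbs = y.natAbs := by
  rcases Int.natAbs_eq_natAbs_iff.1 h with h | h
  · rw [hw.1.1 h]
  · rw [← hw.2.1] at h
    rw [hw.1.1 h, Int.natAbs_neg]

/-- The window `w(1), …, w(n)` of a map. -/
def window (n : ℕ) (w : ℤ → ℤ) : List ℤ := (List.range n).map fun i : ℕ => w ((i : ℤ) + 1)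

@[simp] lemma length_window (n : ℕ) (w : ℤ → ℤ) : (window n w).length = n := by simp [window]

@[simp] lemma getElem_window (n : ℕ) (w : ℤ → ℤ) (i : ℕ) (h : i < (window n w).length) :
    (window n w)[i] = w ((i : ℤ) + 1) := by simp [window]

lemma nodup_window {n : ℕ} {w : ℤ → ℤ} (hw : w ∈ SignedPerms n) :
    ((window n w).map Int.natAbs).Nodup := by
  rw [window, List.map_map]
  refine List.nodup_range.map_on fun i _ j _ h => ?_
  have := SignedPerms.natAbs_eq_of_apply hw h
  omega

lemma toFinset_window {n : ℕ} {w : ℤ → ℤ} (hw : w ∈ SignedPerms n) :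
    ((window n w).map Int.natAbs).toFinset = Finset.Icc 1 n := by
  refine Finset.eq_of_subset_of_card_le ?_ ?_
  · intro a ha
    simp only [window, List.map_map, List.mem_toFinset, List.mem_map, List.mem_range,
      Function.comp] at ha
    obtain ⟨i, hi, rfl⟩ := ha
    rw [Finset.mem_Icc]
    constructor
    · by_contra h
      have h0 : w ((i : ℤ) + 1) = w 0 := by rw [SignedPerms.map_zero hw]; omega
      have := hw.1.1 h0
      omega
    · by_contra h
      have := hw.1.1 (hw.2.2 (w ((i : ℤ) + 1)) (by rw [Int.abs_eq_natAbs]; omega))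
      omega
  · rw [List.toFinset_card_of_nodup (nodup_window hw)]
    simp

lemma injOn_window (n : ℕ) : Set.InjOn (window n) (SignedPerms n) := by
  intro w hw w' hw' h
  have hpos : ∀ i < n, w ((i : ℤ) + 1) = w' ((i : ℤ) + 1) := fun i hi => by
    have := List.getElem_of_eq h (i := i) (by simpa using hi)
    simpa using this
  have hnonneg : ∀ a : ℕ, w a = w' a := by
    intro a
    rcases a with _ | i
    · simp [SignedPerms.map_zero hw, SignedPerms.map_zero hw']
    · by_cases hi : i < n
      · simpa using hpos i hi
      · have hbig : (n : ℤ) < |((i + 1 : ℕ) : ℤ)| := by rw [Nat.abs_cast]; omega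
        rw [hw.2.2 _ hbig, hw'.2.2 _ hbig]
  ext z
  rcases Int.eq_nat_or_neg z with ⟨a, rfl | rfl⟩
  · exact hnonneg a
  · rw [hw.2.1, hw'.2.1, hnonneg]

lemma exists_window_eq {n : ℕ} {l : List ℤ} (hnd : (l.map Int.natAbs).Nodup)
    (hl : (l.map Int.natAbs).toFinset = Finset.Icc 1 n) : ∃ w ∈ SignedPerms n, window n w = l := by
  have hlen : l.length = n := by
    have := List.toFinset_card_of_nodup hnd
    rw [hl, List.length_map] at this
    simpa using this.symm
  have hmem : ∀ a : ℕ, (∃ x ∈ l, x.natAbs = a) ↔ 1 ≤ a ∧ a ≤ n := fun a => by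
    rw [← Finset.mem_Icc, ← hl]; simp
  have hinj : ∀ i (hi : i < n) j (hj : j < n),
      l[i].natAbs = l[j].natAbs → i = j := fun i hi j hj h =>
    (List.Nodup.getElem_inj_iff hnd (i := i) (j := j) (hi := by simp; omega)
      (hj := by simp; omega)).1 (by simpa using h)
  let w : ℤ → ℤ := fun z => if z.natAbs ≤ n then z.sign * l.getD (z.natAbs - 1) 0 else z
  have hw_pos : ∀ i (hi : i < n), w ((i : ℤ) + 1) = l[i] := fun i hi => by
    have h1 : ((i : ℤ) + 1).natAbs = i + 1 := by omega
    have h2 : ((i : ℤ) + 1).sign = 1 := Int.sign_eq_one_of_pos (by omega)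
    simp only [w, h1, h2]
    rw [if_pos (by omega), one_mul, Nat.add_sub_cancel, List.getD_eq_getElem]
  have hw_zero : w 0 = 0 := by simp [w]
  have hw_neg : ∀ z, w (-z) = -w z := fun z => by
    simp only [w, Int.natAbs_neg, Int.sign_neg]
    split_ifs <;> ring
  have hw_big : ∀ z : ℤ, n < z.natAbs → w z = z := fun z hz => by
    simp only [w]
    rw [if_neg (by omega)]
  have hrange : ∀ i (hi : i < n), 1 ≤ l[i].natAbs ∧ l[i].natAbs ≤ n := fun i hi =>
    (hmem _).1 ⟨l[i], List.getElem_mem _, rfl⟩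
  have hcases : ∀ z : ℤ, z = 0 ∨ (∃ i, i < n ∧ z = (i : ℤ) + 1) ∨
      (∃ i, i < n ∧ z = -((i : ℤ) + 1)) ∨ n < z.natAbs := fun z => by
    rcases lt_trichotomy z 0 with h | h | h
    · by_cases hz : z.natAbs ≤ n
      · exact Or.inr (Or.inr (Or.inl ⟨z.natAbs - 1, by omega, by omega⟩))
      · exact Or.inr (Or.inr (Or.inr (by omega)))
    · exact Or.inl h
    · by_cases hz : z.natAbs ≤ n
      · exact Or.inr (Or.inl ⟨z.natAbs - 1, by omega, by omega⟩)
      · exact Or.inr (Or.inr (Or.inr (by omega)))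
  refine ⟨w, ⟨⟨?_, ?_⟩, hw_neg, fun z hz => hw_big z (by rw [Int.abs_eq_natAbs] at hz; omega)⟩, ?_⟩
  · intro x y h
    rcases hcases x with rfl | ⟨i, hi, rfl⟩ | ⟨i, hi, rfl⟩ | hx <;>
    rcases hcases y with rfl | ⟨j, hj, rfl⟩ | ⟨j, hj, rfl⟩ | hy <;>
    simp only [*] at h <;>
    (try have hi' := hrange i hi) <;> (try have hj' := hrange j hj) <;>
    (try have hij := hinj i hi j hj (by omega)) <;> (try subst hij) <;> omega
  · intro y
    by_cases hy : 1 ≤ y.natAbs ∧ y.natAbs ≤ n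
    · obtain ⟨x, hx, hxy⟩ := (hmem _).2 hy
      obtain ⟨i, hi, rfl⟩ := List.getElem_of_mem hx
      rcases Int.natAbs_eq_natAbs_iff.1 hxy with h | h
      · exact ⟨(i : ℤ) + 1, by rw [hw_pos i (by omega), h]⟩
      · exact ⟨-((i : ℤ) + 1), by rw [hw_neg, hw_pos i (by omega), h, neg_neg]⟩
    · by_cases h0 : y = 0
      · exact ⟨0, by rw [hw_zero, h0]⟩
      · exact ⟨y, hw_big y (by omega)⟩
  · refine List.ext_getElem (by simp [hlen]) fun i h1 h2 => ?_
    rw [getElem_window, hw_pos i (by omega)]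

lemma desB_subset_iff {n m : ℕ} {γ : List ℕ} (hγ : ∀ i ∈ γ, 0 < i) (hsum : m + γ.sum = n)
    {w : ℤ → ℤ} (hw : w ∈ SignedPerms n) :
    DesB n w ⊆ partialSums m γ ↔ m ≤ (window n w).length ∧
      (0 :: (window n w).take m).Pairwise (· < ·) ∧ IncreasingBlocks γ ((window n w).drop m) := by
  have h := increasingBlocks_iff (γ := (m + 1) :: γ) (by simpa using hγ) 0 (0 :: window n w)
    (by simp; omega)
  have hget : ∀ j (hj : j < (0 :: window n w).length), (0 :: window n w)[j] = w j := by
    rintro (_ | j) hj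
    · simp [SignedPerms.map_zero hw]
    · simp
  simp only [hget] at h
  rw [IncreasingBlocks, List.take_succ_cons, List.drop_succ_cons, List.length_cons,
    add_le_add_iff_right] at h
  rw [h]
  simp only [length_window, partialSums, zero_add, Finset.mem_insert, add_one_mem_partialSums]
  constructor
  · intro hD j hj hm
    have hne : w ((j : ℤ) + 1) ≠ w j := fun he => by have := hw.1.1 he; omega
    by_contra hlt
    refine hm (Or.inr (hD ⟨by omega, lt_of_le_of_ne ?_ hne⟩))
    push_cast at hlt
    omega
  · rintro hD i ⟨hi, hlt⟩
    by_contra hm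
    have := hD i (by omega) (by simpa using hm)
    push_cast at this
    omega

lemma image_window {n m : ℕ} {γ : List ℕ} (hγ : ∀ i ∈ γ, 0 < i) (hsum : m + γ.sum = n) :
    window n '' {w ∈ SignedPerms n | DesB n w ⊆ partialSums m γ} =
      signedWords m γ (Finset.Icc 1 n) := by
  ext l
  rw [Finset.mem_coe, mem_signedWords (by simp)]
  constructor
  · rintro ⟨w, ⟨hw, hD⟩, rfl⟩
    exact ⟨nodup_window hw, toFinset_window hw, (desB_subset_iff hγ hsum hw).1 hD⟩
  · rintro ⟨h1, h2, h3⟩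
    obtain ⟨w, hw, rfl⟩ := exists_window_eq h1 h2
    exact ⟨w, ⟨hw, (desB_subset_iff hγ hsum hw).2 h3⟩, rfl⟩

lemma finite_signedPerms (n : ℕ) : (SignedPerms n).Finite := by
  obtain ⟨m, γ, hγ, hsum, h⟩ := exists_partialSums_eq n (Finset.range n) (by simp)
  have heq : {w ∈ SignedPerms n | DesB n w ⊆ partialSums m γ} = SignedPerms n := by
    rw [h]
    exact Set.sep_eq_self_iff_mem_true.2 fun w _ i hi => by simpa using hi.1
  refine Set.Finite.of_finite_image ?_ (injOn_window n)
  rw [← heq, image_window hγ hsum]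
  exact Finset.finite_toSet _

lemma ncard_desB_subset {n m : ℕ} {γ : List ℕ} (hγ : ∀ i ∈ γ, 0 < i) (hsum : m + γ.sum = n) :
    {w ∈ SignedPerms n | DesB n w ⊆ partialSums m γ}.ncard =
      2 ^ (n - m) * (n.factorial / ((m :: γ).map Nat.factorial).prod) := by
  rw [← ((injOn_window n).mono fun _ h => h.1).ncard_image, image_window hγ hsum,
    Set.ncard_coe_finset]
  have h1 := card_signedWords_mul m γ (Finset.Icc 1 n) (by simp) (by simp [hsum])
  have h2 : ((m :: γ).map Nat.factorial).prod ∣ n.factorial := by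
    have h := card_blockWords_mul (m :: γ) (Finset.Icc (1 : ℤ) n) (by simp [hsum])
    rw [Int.card_Icc, add_sub_cancel_right, Int.toNat_natCast] at h
    exact Dvd.intro_left _ h
  have hpos : 0 < ((m :: γ).map Nat.factorial).prod :=
    List.prod_pos (by simp [Nat.factorial_pos])
  rw [Nat.card_Icc, Nat.add_sub_cancel] at h1
  rw [← Nat.mul_div_assoc _ h2, show n - m = γ.sum by omega, ← h1, Nat.mul_div_cancel _ hpos]

lemma sum_powerset_neg_one_pow_ite_subset (S U : Finset ℕ) :
    ∑ T ∈ S.powerset, (-1 : ℤ) ^ (S.card - T.card) * (if U ⊆ T then 1 else 0) =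
      if U = S then 1 else 0 := by
  by_cases hU : U ⊆ S
  · have hiff : S \ U = ∅ ↔ U = S := by
      rw [Finset.sdiff_eq_empty_iff_subset]
      exact ⟨fun h => hU.antisymm h, fun h => h.ge⟩
    simp only [mul_ite, mul_one, mul_zero]
    rw [← Finset.sum_filter]
    simp only [← hiff]
    rw [← Finset.sum_powerset_neg_one_pow_card]
    refine Finset.sum_nbij' (S \ ·) (S \ ·) ?_ ?_ ?_ ?_ ?_ <;>
      simp only [Finset.mem_filter, Finset.mem_powerset]
    · exact fun T hT => Finset.sdiff_subset_sdiff le_rfl hT.2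
    · exact fun R hR => ⟨Finset.sdiff_subset, Finset.subset_sdiff.2
        ⟨hU, (Finset.subset_sdiff.1 hR).2.symm⟩⟩
    · exact fun T hT => Finset.sdiff_sdiff_eq_self hT.1
    · exact fun R hR => Finset.sdiff_sdiff_eq_self (hR.trans Finset.sdiff_subset)
    · intro T hT
      rw [Finset.card_sdiff_of_subset hT.1]
  · rw [if_neg fun h => hU h.le]
    refine Finset.sum_eq_zero fun T hT => ?_
    rw [if_neg fun h => hU (h.trans (Finset.mem_powerset.1 hT)), mul_zero]

lemma card_filter_eq_alternating_sum {X : Type*} (W : Finset X) (d : X → Finset ℕ)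
    (S : Finset ℕ) :
    ((W.filter fun x => d x = S).card : ℤ) =
      ∑ T ∈ S.powerset, (-1 : ℤ) ^ (S.card - T.card) * ((W.filter fun x => d x ⊆ T).card : ℤ) := by
  simp only [Finset.card_filter, Nat.cast_sum, Nat.cast_ite, Nat.cast_one, Nat.cast_zero,
    Finset.mul_sum]
  rw [Finset.sum_comm]
  exact Finset.sum_congr rfl fun x _ => (sum_powerset_neg_one_pow_ite_subset S (d x)).symm

lemma ncard_desB_eq_alternating_sum (n : ℕ) (S : Finset ℕ) :
    ({w ∈ SignedPerms n | DesB n w = S}.ncard : ℤ) =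
      ∑ T ∈ S.powerset, (-1 : ℤ) ^ (S.card - T.card) *
        ({w ∈ SignedPerms n | DesB n w ⊆ T}.ncard : ℤ) := by
  let d : (ℤ → ℤ) → Finset ℕ := fun w => {i ∈ Finset.range n | w ((i : ℤ) + 1) < w i}
  have hd : ∀ w, DesB n w = d w := fun w => by ext i; simp [d, DesB]
  have hW := finite_signedPerms n
  have hfilter : ∀ p : (ℤ → ℤ) → Prop, ∀ [DecidablePred p],
      {w ∈ SignedPerms n | p w}.ncard = (hW.toFinset.filter p).card := fun p _ => by
    rw [← Set.ncard_coe_finset]; congr 1; ext; simp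
  simp only [hd, Finset.coe_inj, Finset.coe_subset]
  rw [hfilter, card_filter_eq_alternating_sum]
  exact Finset.sum_congr rfl fun T _ => by rw [hfilter]

namespace PseudoComposition

variable {n : ℕ}

/-- The descent set of a pseudo-composition as a finset. -/
def descents (β : PseudoComposition n) : Finset ℕ := partialSums β.parts.headI β.parts.tail

lemma headI_cons_tail (β : PseudoComposition n) :
    β.parts.headI :: β.parts.tail = β.parts := by
  obtain ⟨_ | ⟨m, γ⟩, h, -, -⟩ := β
  · exact absurd rfl h
  · rfl

lemma headI_add_sum_tail (β : PseudoComposition n) :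
    β.parts.headI + β.parts.tail.sum = n := by
  rw [← List.sum_cons, headI_cons_tail, β.sum_eq]

lemma coe_descents (β : PseudoComposition n) : (β.descents : Set ℕ) = DsetB β := by
  ext x
  rw [Finset.mem_coe, descents, mem_partialSums_iff, DsetB, ← headI_cons_tail β]
  simp only [List.tail_cons, List.headI_cons, Set.mem_ofPred_eq, List.length_cons]
  constructor
  · rintro ⟨i, hi, rfl⟩
    exact ⟨i + 1, by omega, by omega, by simp⟩
  · rintro ⟨_ | i, h0, hi, rfl⟩
    · omega
    · exact ⟨i, by omega, by simp⟩

lemma card_descents (β : PseudoComposition n) : β.descents.card = β.parts.length - 1 := by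
  rw [descents, card_partialSums _ β.tail_pos, List.length_tail]

lemma descents_injective : Function.Injective (descents (n := n)) := by
  intro β β' h
  obtain ⟨h1, h2⟩ := partialSums_injective β.tail_pos β'.tail_pos
    (β.headI_add_sum_tail.trans β'.headI_add_sum_tail.symm) h
  have : β.parts = β'.parts := by
    rw [← headI_cons_tail β, ← headI_cons_tail β', h1, h2]
  cases β
  cases β'
  simpa using this

lemma mem_range_descents {T : Finset ℕ} :
    T ∈ Set.range (descents (n := n)) ↔ T ⊆ Finset.range n := by
  constructor
  · rintro ⟨β, rfl⟩ x hx
    rw [Finset.mem_range, ← β.headI_add_sum_tail]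
    exact lt_of_mem_partialSums _ β.tail_pos _ hx
  · intro hT
    obtain ⟨m, γ, hγ, hsum, rfl⟩ :=
      exists_partialSums_eq n T fun x hx => Finset.mem_range.1 (hT hx)
    exact ⟨⟨m :: γ, by simp, hγ, by simpa using hsum⟩, rfl⟩

lemma length_sub_length (α β : PseudoComposition n) :
    α.parts.length - β.parts.length = α.descents.card - β.descents.card := by
  have := List.length_pos_of_ne_nil α.ne_nil
  have := List.length_pos_of_ne_nil β.ne_nil
  rw [card_descents, card_descents]
  omega

lemma ncard_desB_subset_descents (β : PseudoComposition n) :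
    {w ∈ SignedPerms n | DesB n w ⊆ β.descents}.ncard =
      2 ^ (n - β.parts.headI) * (n.factorial / (β.parts.map Nat.factorial).prod) := by
  rw [descents, ncard_desB_subset β.tail_pos β.headI_add_sum_tail, headI_cons_tail]

end PseudoComposition

/-- Inclusion-exclusion formula for the type B ribbon number:
r^B_α = Σ_{β ≼ α} (-1)^{ℓ(α)-ℓ(β)} 2^{n-β₁} n!/(β₁!⋯β_ℓ!). -/
theorem ribbonB_eq_alternating_sum {n : ℕ} (α : PseudoComposition n) :
    (ribbonB α : ℤ) =
      ∑ᶠ β : PseudoComposition n,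
        if DsetB β ⊆ DsetB α then
          (-1 : ℤ) ^ (α.parts.length - β.parts.length) *
            (2 ^ (n - β.parts.headI) * (n.factorial / (β.parts.map Nat.factorial).prod) : ℕ)
        else 0 := by
  let f : Finset ℕ → ℤ := fun T => if T ⊆ α.descents then
    (-1 : ℤ) ^ (α.descents.card - T.card) * ({w ∈ SignedPerms n | DesB n w ⊆ T}.ncard : ℤ) else 0
  have hf : ∀ T ∉ α.descents.powerset, f T = 0 := fun T hT =>
    if_neg fun h => hT (Finset.mem_powerset.2 h)
  calc (ribbonB α : ℤ) = ∑ T ∈ α.descents.powerset, f T := by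
        rw [ribbonB, ← α.coe_descents, ncard_desB_eq_alternating_sum]
        exact Finset.sum_congr rfl fun T hT => (if_pos (Finset.mem_powerset.1 hT)).symm
    _ = ∑ᶠ T ∈ Set.range (PseudoComposition.descents (n := n)), f T := by
        refine (finsum_mem_eq_sum_of_subset f ?_ ?_).symm
        · exact fun T hT => by_contra fun h => hT.2 (hf T h)
        · exact fun T hT => PseudoComposition.mem_range_descents.2 <|
            (Finset.mem_powerset.1 hT).trans (PseudoComposition.mem_range_descents.1 ⟨α, rfl⟩)
    _ = ∑ᶠ β : PseudoComposition n, f β.descents :=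
        finsum_mem_range PseudoComposition.descents_injective
    _ = _ := by
        refine finsum_congr fun β => ?_
        simp only [f, ← PseudoComposition.coe_descents, Finset.coe_subset,
          PseudoComposition.ncard_desB_subset_descents, PseudoComposition.length_sub_length]
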